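/- Fix d, s, σ > 0, β > 0, and set the null distribution P_0 on ℝ^{d+1} to be N(0, A_0) with A_0 = diag(σ² + s β², I_d). For v ∈ {-1,0,1}^d with exactly s nonzero entries, let P_v be the distribution of Z = (Y, X) where X ~ N(0, I_d), ε ~ N(0, σ²) independent, η Rademacher independent, and Y = η β vᵀX + ε. Then for any two such vectors v₁, v₂: E_{P_0}[ (dP_{v₁}/dP_0)(Z) · (dP_{v₂}/dP_0)(Z) ] = ( 1 − β⁴ ⟨v₁, v₂⟩² / (σ² + s β²)² )^{-1}. -/

import Mathlib

open MeasureTheory ProbabilityTheory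

/-- The standard Gaussian measure on `ℝ^d`. -/
noncomputable def stdGaussian (d : ℕ) : Measure (Fin d → ℝ) :=
  Measure.pi fun _ => gaussianReal 0 1

/-- `G(s)`: vectors in `{-1,0,1}^d` with exactly `s` nonzero entries. -/
def sparseSigns (d s : ℕ) : Set (Fin d → ℤ) :=
  {v | (∀ i, v i = -1 ∨ v i = 0 ∨ v i = 1) ∧ Nat.card {i : Fin d // v i ≠ 0} = s}

/-- Distribution of `Z = (Y, X)` in the symmetric mixture of regressions
`Y = η β vᵀ X + ε`, `X ~ N(0, I_d)`, `ε ~ N(0, σ²)`, `η` Rademacher, all independent. -/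
noncomputable def regMix (d : ℕ) (σ β : NNReal) (v : Fin d → ℤ) :
    Measure (ℝ × (Fin d → ℝ)) :=
  (2⁻¹ : ENNReal) • Measure.map
      (fun p => ((β : ℝ) * (∑ i, (v i : ℝ) * p.2 i) + p.1, p.2))
      ((gaussianReal 0 (σ ^ 2)).prod (stdGaussian d))
  + (2⁻¹ : ENNReal) • Measure.map
      (fun p => (-(β : ℝ) * (∑ i, (v i : ℝ) * p.2 i) + p.1, p.2))
      ((gaussianReal 0 (σ ^ 2)).prod (stdGaussian d))

/-- The null distribution `P₀ = N(0, diag(σ² + s β², I_d))` on `ℝ^{d+1}`. -/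
noncomputable def regNull (d s : ℕ) (σ β : NNReal) : Measure (ℝ × (Fin d → ℝ)) :=
  (gaussianReal 0 (σ ^ 2 + s * β ^ 2)).prod (stdGaussian d)

/-- A pair of linear forms of a standard Gaussian vector is jointly Gaussian. -/
lemma hasGaussianLaw_linearForm_pair {d : ℕ} (a b : Fin d → ℝ) :
    HasGaussianLaw (fun x : Fin d → ℝ => (∑ i, a i * x i, ∑ i, b i * x i))
      (Measure.pi fun _ => gaussianReal 0 1) := by
  have hind : iIndepFun (fun (i : Fin d) (x : Fin d → ℝ) => x i)
      (Measure.pi fun _ => gaussianReal 0 1) :=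
    iIndepFun_pi (X := fun _ x => x) fun _ => aemeasurable_id
  have hid : HasGaussianLaw (fun (x : Fin d → ℝ) => (x ·))
      (Measure.pi fun _ => gaussianReal 0 1) := by
    refine iIndepFun.hasGaussianLaw (fun i => ⟨?_⟩) hind
    rw [(measurePreserving_eval (fun _ : Fin d => gaussianReal 0 1) i).map_eq]
    infer_instance
  simpa using hid.map_fun
    ((∑ i, a i • ContinuousLinearMap.proj (R := ℝ) (φ := fun _ : Fin d => ℝ) i).prod
      (∑ i, b i • ContinuousLinearMap.proj (R := ℝ) (φ := fun _ : Fin d => ℝ) i))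

lemma covariance_linearForm {d : ℕ} (a b : Fin d → ℝ) :
    cov[fun x => ∑ i, a i * x i, fun x => ∑ i, b i * x i;
      Measure.pi fun _ => gaussianReal 0 1] = ∑ i, a i * b i := by
  have hL (i : Fin d) : MemLp (fun x : Fin d → ℝ => x i) 2
      (Measure.pi fun _ => gaussianReal 0 1) :=
    (memLp_id_gaussianReal' 2 (by simp)).comp_measurePreserving
      (measurePreserving_eval (fun _ : Fin d => gaussianReal 0 1) i)
  have hind : iIndepFun (fun (i : Fin d) (x : Fin d → ℝ) => x i)
      (Measure.pi fun _ => gaussianReal 0 1) :=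
    iIndepFun_pi (X := fun _ x => x) fun _ => aemeasurable_id
  have hcov (i j : Fin d) : cov[fun x : Fin d → ℝ => x i, fun x => x j;
      Measure.pi fun _ => gaussianReal 0 1] = if i = j then 1 else 0 := by
    split_ifs with h
    · subst h
      rw [covariance_self (measurable_pi_apply i).aemeasurable]
      have := (measurePreserving_eval (fun _ : Fin d => gaussianReal 0 1) i).variance_fun_comp
        (f := id) aemeasurable_id
      simpa using this
    · exact (hind.indepFun h).covariance_eq_zero (hL i) (hL j)
  rw [covariance_fun_sum_fun_sum (fun i => (hL i).const_mul _) fun i => (hL i).const_mul _]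
  simp_rw [covariance_const_mul_left, covariance_const_mul_right, hcov]
  simp

lemma map_linearForm {d : ℕ} (a : Fin d → ℝ) :
    (Measure.pi fun _ => gaussianReal 0 1).map (fun x => ∑ i, a i * x i)
      = gaussianReal 0 (∑ i, a i ^ 2).toNNReal := by
  have h := (hasGaussianLaw_linearForm_pair a a).fst.map_eq_gaussianReal
  have hmean : ∫ x : Fin d → ℝ, ∑ i, a i * x i ∂(Measure.pi fun _ => gaussianReal 0 1) = 0 := by
    have hint (i : Fin d) : Integrable (fun x : Fin d → ℝ => x i)
        (Measure.pi fun _ => gaussianReal 0 1) :=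
      ((memLp_id_gaussianReal' 1 (by simp)).comp_measurePreserving
        (measurePreserving_eval (fun _ : Fin d => gaussianReal 0 1) i)).integrable le_rfl
    rw [integral_finsetSum _ fun i _ => (hint i).const_mul _]
    refine Finset.sum_eq_zero fun i _ => ?_
    have := integral_comp_eval (μ := fun _ : Fin d => gaussianReal 0 1) (i := i) (f := id)
      aestronglyMeasurable_id
    simp only [id] at this
    rw [integral_const_mul, this, integral_id_gaussianReal, mul_zero]
  rw [hmean, ← covariance_self (Measurable.aemeasurable (by fun_prop)), covariance_linearForm] at h
  simpa only [pow_two] using h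

/-- The moment generating function of the square of a centred Gaussian variable. -/
lemma lintegral_exp_mul_sq_gaussianReal (v : NNReal) (t : ℝ) (h : 2 * t * v < 1) :
    ∫⁻ x, ENNReal.ofReal (Real.exp (t * x ^ 2)) ∂gaussianReal 0 v
      = ENNReal.ofReal (√(1 - 2 * t * v))⁻¹ := by
  rcases eq_or_ne v 0 with rfl | hv
  · simp [gaussianReal_zero_var]
  have hv0 : (0 : ℝ) < v := by positivity
  have hc : 0 < 1 - 2 * t * v := by linarith
  obtain ⟨V, hV⟩ : ∃ V : NNReal, (V : ℝ) = v / (1 - 2 * t * v) :=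
    ⟨⟨v / (1 - 2 * t * v), by positivity⟩, rfl⟩
  have hV0 : V ≠ 0 := by
    rw [← NNReal.coe_ne_zero, hV]; positivity
  rw [gaussianReal_of_var_ne_zero _ hv,
    lintegral_withDensity_eq_lintegral_mul _ (measurable_gaussianPDF _ _) (by fun_prop)]
  have key (x : ℝ) : gaussianPDFReal 0 v x * Real.exp (t * x ^ 2)
      = (√(1 - 2 * t * v))⁻¹ * gaussianPDFReal 0 V x := by
    rw [gaussianPDFReal_def, gaussianPDFReal_def, mul_assoc, ← Real.exp_add, ← mul_assoc, hV,
      ← mul_inv, ← Real.sqrt_mul hc.le]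
    congr 1
    · congr 2
      rw [mul_left_comm, mul_div_cancel₀ _ hc.ne']
    · congr 1
      field_simp
      ring
  simp only [Pi.mul_apply, gaussianPDF]
  simp_rw [← ENNReal.ofReal_mul (gaussianPDFReal_nonneg _ _ _), key,
    ENNReal.ofReal_mul (inv_nonneg.2 (Real.sqrt_nonneg _))]
  rw [lintegral_const_mul _ (by fun_prop), lintegral_gaussianPDFReal_eq_one _ hV0, mul_one]

lemma gaussianPDFReal_mul_div (u w K V : NNReal) (hu : u ≠ 0) (hw : w ≠ 0) (hK : K ≠ 0)
    (huw : (K : ℝ) = 2 * w - u) (hV : (V : ℝ) = u * w / K) (A B y : ℝ) :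
    gaussianPDFReal A u y * gaussianPDFReal B u y / gaussianPDFReal 0 w y
      = w / √(u * K) * (Real.exp ((-(1 / (4 * u))) * (A - B) ^ 2)
          * Real.exp (1 / (4 * K) * (A + B) ^ 2))
        * gaussianPDFReal ((A + B) * w / K) V y := by
  have hu0 : (0 : ℝ) < u := by positivity
  have hw0 : (0 : ℝ) < w := by positivity
  have hK0 : (0 : ℝ) < K := by positivity
  simp only [gaussianPDFReal_def]
  have hconst : (√(2 * Real.pi * u))⁻¹ * (√(2 * Real.pi * u))⁻¹ / (√(2 * Real.pi * w))⁻¹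
      = w / √(u * K) * (√(2 * Real.pi * V))⁻¹ := by
    rw [← mul_inv, Real.mul_self_sqrt (by positivity), div_inv_eq_mul, div_mul_eq_mul_div,
      ← div_eq_mul_inv, div_div, ← Real.sqrt_mul (by positivity), inv_mul_eq_div]
    have : 2 * Real.pi * V * ((u : ℝ) * K) = (2 * Real.pi * w) * u ^ 2 := by
      rw [hV]; field_simp
    rw [this, Real.sqrt_mul (by positivity) ((u : ℝ) ^ 2), Real.sqrt_sq hu0.le]
    have hs : √(2 * Real.pi * w) ≠ 0 := by positivity
    have hq : √(2 * Real.pi * w) ^ 2 = 2 * Real.pi * w := Real.sq_sqrt (by positivity)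
    field_simp
    linarith
  have hexp : Real.exp (-(y - A) ^ 2 / (2 * u)) * Real.exp (-(y - B) ^ 2 / (2 * u))
        / Real.exp (-(y - 0) ^ 2 / (2 * w))
      = Real.exp ((-(1 / (4 * u))) * (A - B) ^ 2) * Real.exp (1 / (4 * K) * (A + B) ^ 2)
        * Real.exp (-(y - (A + B) * w / K) ^ 2 / (2 * V)) := by
    rw [← Real.exp_add, ← Real.exp_add, ← Real.exp_add, ← Real.exp_sub, hV]
    congr 1
    have hu' : (u : ℝ) = 2 * w - K := by linarith
    rw [hu'] at hu0 ⊢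
    field_simp
    ring
  calc _ = ((√(2 * Real.pi * u))⁻¹ * (√(2 * Real.pi * u))⁻¹ / (√(2 * Real.pi * w))⁻¹)
        * (Real.exp (-(y - A) ^ 2 / (2 * u)) * Real.exp (-(y - B) ^ 2 / (2 * u))
          / Real.exp (-(y - 0) ^ 2 / (2 * w))) := by ring
    _ = _ := by rw [hconst, hexp]; ring

/-- Likelihood ratio of `Y ~ N(⟨a, X⟩, u)` given `X` against `Y ~ N(0, w)`. -/
noncomputable def regLikelihoodRatio {d : ℕ} (u w : NNReal) (a : Fin d → ℝ)
    (z : ℝ × (Fin d → ℝ)) : ENNReal :=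
  ENNReal.ofReal (gaussianPDFReal (∑ i, a i * z.2 i) u z.1 / gaussianPDFReal 0 w z.1)

@[fun_prop]
lemma measurable_regLikelihoodRatio {d : ℕ} (u w : NNReal) (a : Fin d → ℝ) :
    Measurable (regLikelihoodRatio u w a) := by
  unfold regLikelihoodRatio
  simp only [gaussianPDFReal_def]
  fun_prop

lemma map_linearRegression {d : ℕ} {u w : NNReal} (hu : u ≠ 0) (hw : w ≠ 0) (a : Fin d → ℝ)
    (γ : Measure (Fin d → ℝ)) [SFinite γ] :
    Measure.map (fun p => (∑ i, a i * p.2 i + p.1, p.2)) ((gaussianReal 0 u).prod γ)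
      = ((gaussianReal 0 w).prod γ).withDensity (regLikelihoodRatio u w a) := by
  have hmeas : Measurable fun p : ℝ × (Fin d → ℝ) => (∑ i, a i * p.2 i + p.1, p.2) := by
    fun_prop
  refine Measure.ext_of_lintegral _ fun f hf => ?_
  rw [lintegral_map hf hmeas, lintegral_prod_symm' _ (by fun_prop),
    lintegral_withDensity_eq_lintegral_mul _ (by fun_prop) hf, lintegral_prod_symm' _
      ((measurable_regLikelihoodRatio u w a).mul hf)]
  refine lintegral_congr fun x => ?_
  have hfx : Measurable fun y => f (y, x) := by fun_prop
  have h := lintegral_map (μ := gaussianReal 0 u) hfx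
    (g := fun y => ∑ i, a i * x i + y) (by fun_prop)
  have hLf : Measurable fun y => (regLikelihoodRatio u w a * f) (y, x) :=
    ((measurable_regLikelihoodRatio u w a).mul hf).comp measurable_prodMk_right
  rw [← h, gaussianReal_map_const_add, gaussianReal_of_var_ne_zero _ hu,
    gaussianReal_of_var_ne_zero _ hw, zero_add,
    lintegral_withDensity_eq_lintegral_mul _ (measurable_gaussianPDF _ _) hfx,
    lintegral_withDensity_eq_lintegral_mul _ (measurable_gaussianPDF _ _) hLf]
  refine lintegral_congr fun y => ?_
  simp only [Pi.mul_apply, regLikelihoodRatio, gaussianPDF, ← mul_assoc]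
  rw [← ENNReal.ofReal_mul (gaussianPDFReal_nonneg _ _ _),
    mul_div_cancel₀ _ (gaussianPDFReal_pos 0 w y hw).ne']

/-- Integrating out the response in the product of two likelihood ratios. -/
lemma lintegral_regLikelihoodRatio_mul_fst {d : ℕ} {u w K : NNReal} (hu : u ≠ 0) (hw : w ≠ 0)
    (hK : K ≠ 0) (huw : (K : ℝ) = 2 * w - u) (a b : Fin d → ℝ) (x : Fin d → ℝ) :
    ∫⁻ y, regLikelihoodRatio u w a (y, x) * regLikelihoodRatio u w b (y, x) ∂gaussianReal 0 w
      = ENNReal.ofReal (w / √(u * K))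
        * (ENNReal.ofReal (Real.exp (-(1 / (4 * u)) * (∑ i, (a - b) i * x i) ^ 2))
          * ENNReal.ofReal (Real.exp (1 / (4 * K) * (∑ i, (a + b) i * x i) ^ 2))) := by
  have hV : ((u * w / K : NNReal) : ℝ) = u * w / K := by push_cast; rfl
  have hV0 : u * w / K ≠ 0 := by positivity
  rw [gaussianReal_of_var_ne_zero _ hw,
    lintegral_withDensity_eq_lintegral_mul _ (measurable_gaussianPDF _ _) (by fun_prop)]
  have hsub : ∑ i, (a - b) i * x i = ∑ i, a i * x i - ∑ i, b i * x i := by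
    simp [sub_mul]
  have hadd : ∑ i, (a + b) i * x i = ∑ i, a i * x i + ∑ i, b i * x i := by
    simp [add_mul, Finset.sum_add_distrib]
  rw [hsub, hadd]
  set A := ∑ i, a i * x i with hA
  set B := ∑ i, b i * x i with hB
  have key (y : ℝ) : gaussianPDF 0 w y
        * (regLikelihoodRatio u w a (y, x) * regLikelihoodRatio u w b (y, x))
      = ENNReal.ofReal (w / √(u * K))
        * (ENNReal.ofReal (Real.exp (-(1 / (4 * u)) * (A - B) ^ 2))
          * ENNReal.ofReal (Real.exp (1 / (4 * K) * (A + B) ^ 2)))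
        * ENNReal.ofReal (gaussianPDFReal ((A + B) * w / K) (u * w / K) y) := by
    have h0 := gaussianPDFReal_pos 0 w y hw
    have hA0 := gaussianPDFReal_nonneg A u y
    rw [← ENNReal.ofReal_mul (Real.exp_nonneg _), ← ENNReal.ofReal_mul (by positivity),
      ← ENNReal.ofReal_mul (by positivity),
      ← gaussianPDFReal_mul_div u w K _ hu hw hK huw hV]
    simp only [regLikelihoodRatio, gaussianPDF, ← hA, ← hB]
    rw [← ENNReal.ofReal_mul (by positivity), ← ENNReal.ofReal_mul h0.le]
    congr 1
    field_simp
  simp only [Pi.mul_apply, key]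
  rw [lintegral_const_mul _ (by fun_prop), lintegral_gaussianPDFReal_eq_one _ hV0, mul_one]

lemma lintegral_regLikelihoodRatio_mul {d : ℕ} {u w : NNReal} (hu : u ≠ 0) (hw : w ≠ 0)
    (a b : Fin d → ℝ) (ha : u + ∑ i, a i ^ 2 = w) (hb : u + ∑ i, b i ^ 2 = w) :
    ∫⁻ z, regLikelihoodRatio u w a z * regLikelihoodRatio u w b z
        ∂((gaussianReal 0 w).prod (Measure.pi fun _ => gaussianReal 0 1))
      = ENNReal.ofReal (1 - (∑ i, a i * b i) / w)⁻¹ := by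
  have hu0 : (0 : ℝ) < u := by positivity
  have hw0 : (0 : ℝ) < w := by positivity
  have hr : 0 ≤ ∑ i, a i ^ 2 := Finset.sum_nonneg fun _ _ => sq_nonneg _
  have hsub : ∑ i, (a - b) i ^ 2 = ∑ i, a i ^ 2 + ∑ i, b i ^ 2 - 2 * ∑ i, a i * b i := by
    rw [Finset.mul_sum, ← Finset.sum_add_distrib, ← Finset.sum_sub_distrib]
    exact Finset.sum_congr rfl fun i _ => by simp only [Pi.sub_apply]; ring
  have hadd : ∑ i, (a + b) i ^ 2 = ∑ i, a i ^ 2 + ∑ i, b i ^ 2 + 2 * ∑ i, a i * b i := by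
    rw [Finset.mul_sum, ← Finset.sum_add_distrib, ← Finset.sum_add_distrib]
    exact Finset.sum_congr rfl fun i _ => by simp only [Pi.add_apply]; ring
  have hsub0 : 0 ≤ ∑ i, (a - b) i ^ 2 := Finset.sum_nonneg fun _ _ => sq_nonneg _
  have hadd0 : 0 ≤ ∑ i, (a + b) i ^ 2 := Finset.sum_nonneg fun _ _ => sq_nonneg _
  obtain ⟨K, huw⟩ : ∃ K : NNReal, (K : ℝ) = 2 * w - u := ⟨⟨2 * w - u, by linarith⟩, rfl⟩
  have hK0 : (0 : ℝ) < K := by linarith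
  have hK : K ≠ 0 := by rw [← NNReal.coe_ne_zero]; exact hK0.ne'
  have hind : IndepFun (fun x : Fin d → ℝ => ∑ i, (a - b) i * x i)
      (fun x => ∑ i, (a + b) i * x i) (Measure.pi fun _ => gaussianReal 0 1) := by
    refine (hasGaussianLaw_linearForm_pair _ _).indepFun_of_covariance_eq_zero ?_
    rw [covariance_linearForm]
    have : ∑ i, (a - b) i * (a + b) i = ∑ i, a i ^ 2 - ∑ i, b i ^ 2 := by
      rw [← Finset.sum_sub_distrib]
      exact Finset.sum_congr rfl fun i _ => by simp only [Pi.sub_apply, Pi.add_apply]; ring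
    linarith
  have hexp (t : ℝ) : Measurable fun s : ℝ => ENNReal.ofReal (Real.exp (t * s ^ 2)) := by
    fun_prop
  have hform (c : Fin d → ℝ) : Measurable fun x : Fin d → ℝ => ∑ i, c i * x i := by fun_prop
  have hmgf (c : Fin d → ℝ) (t : ℝ) (ht : 2 * t * ∑ i, c i ^ 2 < 1) :
      ∫⁻ x, ENNReal.ofReal (Real.exp (t * (∑ i, c i * x i) ^ 2))
        ∂(Measure.pi fun _ => gaussianReal 0 1)
      = ENNReal.ofReal (√(1 - 2 * t * ∑ i, c i ^ 2))⁻¹ := by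
    have hc : 0 ≤ ∑ i, c i ^ 2 := Finset.sum_nonneg fun _ _ => sq_nonneg _
    rw [← lintegral_map (hexp t) (hform c), map_linearForm, lintegral_exp_mul_sq_gaussianReal,
      Real.coe_toNNReal _ hc]
    rwa [Real.coe_toNNReal _ hc]
  have hD : 1 - 2 * (-(1 / (4 * u))) * ∑ i, (a - b) i ^ 2 = (w - ∑ i, a i * b i) / u := by
    field_simp
    linarith
  have hS : 1 - 2 * (1 / (4 * K)) * ∑ i, (a + b) i ^ 2 = (w - ∑ i, a i * b i) / K := by
    field_simp
    linarith
  have hρ : 0 < w - ∑ i, a i * b i := by linarith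
  rw [lintegral_prod_symm' _ (by fun_prop)]
  simp_rw [lintegral_regLikelihoodRatio_mul_fst hu hw hK huw]
  rw [lintegral_const_mul _ (by fun_prop)]
  have hmul := lintegral_mul_eq_lintegral_mul_lintegral_of_indepFun
    ((hexp (-(1 / (4 * u)))).comp (hform (a - b))) ((hexp (1 / (4 * K))).comp (hform (a + b)))
    (hind.comp (hexp _) (hexp _))
  simp only [Pi.mul_apply, Function.comp_apply] at hmul
  have hDpos : 0 < (w - ∑ i, a i * b i) / u := by positivity
  have hSpos : 0 < (w - ∑ i, a i * b i) / K := by positivity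
  rw [hmul, hmgf _ _ (by linarith), hmgf _ _ (by linarith), hD, hS,
    ← ENNReal.ofReal_mul (by positivity), ← ENNReal.ofReal_mul (by positivity), ← mul_inv,
    ← Real.sqrt_mul hDpos.le, ← div_eq_mul_inv, div_div, ← Real.sqrt_mul (by positivity)]
  congr 1
  have : (u : ℝ) * K * ((w - ∑ i, a i * b i) / u * ((w - ∑ i, a i * b i) / K))
      = (w - ∑ i, a i * b i) ^ 2 := by field_simp
  rw [this, Real.sqrt_sq hρ.le, one_sub_div hw0.ne', inv_div]

lemma sum_sq_of_mem_sparseSigns {d s : ℕ} {v : Fin d → ℤ} (hv : v ∈ sparseSigns d s) :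
    ∑ i, (v i : ℝ) ^ 2 = s := by
  classical
  have h (i : Fin d) : (v i : ℝ) ^ 2 = if v i ≠ 0 then 1 else 0 := by
    rcases hv.1 i with h | h | h <;> simp [h]
  rw [← hv.2, Nat.card_eq_fintype_card, Fintype.card_subtype]
  simp_rw [h, Finset.sum_boole]

/-- The symmetric mixture of regressions has an explicit density with respect to the null. -/
lemma regMix_eq_withDensity (d s : ℕ) {σ : NNReal} (β : NNReal) (hσ : 0 < σ) (v : Fin d → ℤ) :
    regMix d σ β v = (regNull d s σ β).withDensity (fun z =>
      2⁻¹ * regLikelihoodRatio (σ ^ 2) (σ ^ 2 + s * β ^ 2) (fun i => β * v i) z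
      + 2⁻¹ * regLikelihoodRatio (σ ^ 2) (σ ^ 2 + s * β ^ 2) (fun i => -β * v i) z) := by
  have hu : σ ^ 2 ≠ 0 := by positivity
  have hw : σ ^ 2 + s * β ^ 2 ≠ 0 := by positivity
  have : SFinite (_root_.stdGaussian d) := by unfold _root_.stdGaussian; infer_instance
  have hmap (c : ℝ) := map_linearRegression hu hw (fun i => c * v i) (_root_.stdGaussian d)
  simp only [mul_assoc, ← Finset.mul_sum] at hmap
  rw [regMix, hmap, hmap, regNull, ← withDensity_smul _ (by fun_prop),
    ← withDensity_smul _ (by fun_prop), ← withDensity_add_left (by fun_prop)]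
  rfl

/-- Cross moment of likelihood ratios for the mixture of regressions:
`E_{P₀}[(dP_{v₁}/dP₀)(dP_{v₂}/dP₀)] = (1 - β⁴ ⟨v₁,v₂⟩² / (σ² + s β²)²)⁻¹`. -/
theorem stmt_10 (d s : ℕ) (σ β : NNReal) (hσ : 0 < σ) (hβ : 0 < β)
    (v₁ v₂ : Fin d → ℤ) (hv₁ : v₁ ∈ sparseSigns d s) (hv₂ : v₂ ∈ sparseSigns d s) :
    (∫⁻ z, (regMix d σ β v₁).rnDeriv (regNull d s σ β) z
        * (regMix d σ β v₂).rnDeriv (regNull d s σ β) z ∂(regNull d s σ β)).toReal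
      = (1 - (β : ℝ) ^ 4 * (∑ i, (v₁ i : ℝ) * (v₂ i : ℝ)) ^ 2
            / ((σ : ℝ) ^ 2 + s * (β : ℝ) ^ 2) ^ 2)⁻¹ := by
  set u := σ ^ 2 with hu_def
  set w := σ ^ 2 + s * β ^ 2 with hw_def
  have hu : u ≠ 0 := by positivity
  have hw : w ≠ 0 := by positivity
  have hw0 : (0 : ℝ) < w := by positivity
  have hwr : (w : ℝ) = (σ : ℝ) ^ 2 + s * (β : ℝ) ^ 2 := by rw [hw_def]; push_cast; rfl
  have hσ0 : (0 : ℝ) < σ := hσ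
  have : IsProbabilityMeasure (regNull d s σ β) := by
    unfold regNull _root_.stdGaussian; infer_instance
  have hnorm {v : Fin d → ℤ} (hv : v ∈ sparseSigns d s) (c : ℝ) (hc : c ^ 2 = (β : ℝ) ^ 2) :
      (u : ℝ) + ∑ i, (c * v i) ^ 2 = w := by
    simp_rw [mul_pow, ← Finset.mul_sum]
    rw [sum_sq_of_mem_sparseSigns hv, hwr, hc, hu_def]
    push_cast
    ring
  have hcross (c e : ℝ) (hc : c ^ 2 = (β : ℝ) ^ 2) (he : e ^ 2 = (β : ℝ) ^ 2) :
      ∫⁻ z, regLikelihoodRatio u w (fun i => c * v₁ i) z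
          * regLikelihoodRatio u w (fun i => e * v₂ i) z ∂(regNull d s σ β)
        = ENNReal.ofReal (1 - c * e * (∑ i, (v₁ i : ℝ) * v₂ i) / w)⁻¹ := by
    rw [regNull, _root_.stdGaussian, lintegral_regLikelihoodRatio_mul hu hw _ _ (hnorm hv₁ c hc)
      (hnorm hv₂ e he), Finset.mul_sum]
    simp only [mul_mul_mul_comm]
  set ρ := ∑ i, (v₁ i : ℝ) * v₂ i
  set L : ℝ → (Fin d → ℤ) → ℝ × (Fin d → ℝ) → ENNReal :=
    fun c v => regLikelihoodRatio u w (fun i => c * v i) with hL_def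
  have hL (c : ℝ) (v : Fin d → ℤ) : Measurable (L c v) := measurable_regLikelihoodRatio _ _ _
  have hrn (v : Fin d → ℤ) : (regMix d σ β v).rnDeriv (regNull d s σ β)
      =ᵐ[regNull d s σ β] fun z => 2⁻¹ * L β v z + 2⁻¹ * L (-β) v z := by
    rw [regMix_eq_withDensity d s β hσ v]
    exact Measure.rnDeriv_withDensity _ (by fun_prop)
  have hρ : |ρ| ≤ s := by
    have h := Finset.abs_sum_le_sum_abs (fun i => (v₁ i : ℝ) * v₂ i) Finset.univ
    have h' : ∑ i, |(v₁ i : ℝ) * v₂ i| ≤ ∑ i, ((v₁ i : ℝ) ^ 2 + (v₂ i : ℝ) ^ 2) / 2 :=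
      Finset.sum_le_sum fun i _ => abs_le.2
        ⟨by nlinarith [sq_nonneg ((v₁ i : ℝ) + v₂ i)], by nlinarith [sq_nonneg ((v₁ i : ℝ) - v₂ i)]⟩
    rw [← Finset.sum_div, Finset.sum_add_distrib, sum_sq_of_mem_sparseSigns hv₁,
      sum_sq_of_mem_sparseSigns hv₂] at h'
    linarith
  have ht : |(β : ℝ) ^ 2 * ρ / w| < 1 := by
    rw [abs_div, abs_of_pos hw0, div_lt_one hw0, abs_mul, abs_of_nonneg (by positivity), hwr]
    nlinarith [mul_le_mul_of_nonneg_left hρ (sq_nonneg (β : ℝ)), pow_pos hσ0 2]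
  obtain ⟨ht1, ht2⟩ := abs_lt.1 ht
  have hint : ∫⁻ z, (regMix d σ β v₁).rnDeriv (regNull d s σ β) z
        * (regMix d σ β v₂).rnDeriv (regNull d s σ β) z ∂(regNull d s σ β)
      = ∫⁻ z, 2⁻¹ * 2⁻¹ * (L β v₁ z * L β v₂ z + L β v₁ z * L (-β) v₂ z
        + L (-β) v₁ z * L β v₂ z + L (-β) v₁ z * L (-β) v₂ z) ∂(regNull d s σ β) := by
    refine lintegral_congr_ae ?_
    filter_upwards [hrn v₁, hrn v₂] with z h₁ h₂
    rw [h₁, h₂]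
    ring
  rw [hint, lintegral_const_mul _ (by fun_prop), lintegral_add_left (by fun_prop),
    lintegral_add_left (by fun_prop), lintegral_add_left (by fun_prop)]
  simp only [hL_def]
  rw [hcross _ _ rfl rfl, hcross _ _ rfl (neg_sq _), hcross _ _ (neg_sq _) rfl,
    hcross _ _ (neg_sq _) (neg_sq _), ← hwr]
  have e1 : (β : ℝ) * β * ρ / w = β ^ 2 * ρ / w := by ring
  have e2 : (β : ℝ) * -β * ρ / w = -(β ^ 2 * ρ / w) := by ring
  have e3 : -(β : ℝ) * β * ρ / w = -(β ^ 2 * ρ / w) := by ring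
  have e4 : -(β : ℝ) * -β * ρ / w = β ^ 2 * ρ / w := by ring
  have e5 : (β : ℝ) ^ 4 * ρ ^ 2 / (w : ℝ) ^ 2 = (β ^ 2 * ρ / w) ^ 2 := by ring
  rw [e1, e2, e3, e4, e5]
  generalize (β : ℝ) ^ 2 * ρ / w = t at *
  have h1 : 0 < 1 - t := by linarith
  have h2 : 0 < 1 - -t := by linarith
  have h3 : 1 - t ^ 2 = (1 - t) * (1 - -t) := by ring
  rw [← ENNReal.ofReal_add (by positivity) (by positivity),
    ← ENNReal.ofReal_add (by positivity) (by positivity),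
    ← ENNReal.ofReal_add (by positivity) (by positivity), ENNReal.toReal_mul,
    ENNReal.toReal_ofReal (by positivity), h3]
  simp only [ENNReal.toReal_mul, ENNReal.toReal_inv, ENNReal.toReal_ofNat]
  field_simp
  ring
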